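/- arXiv:1404.0345 — 2 statements merged into one kernel-verified Lean document; each statement's English description precedes it below -/
import Mathlib

section
/- Let d ≥ 1, β ∈ (0,1], θ₁, θ₂ ∈ ℝ, and set θ = max(θ₁, θ₂). Then there is a constant N = N(β, θ₁, θ₂) such that for every φ: ℝ^d → ℝ with N₁ := |r₁^{−θ₁}φ|₀ + [r₁^{−θ₂}φ]_β < ∞ one has |r₁^{−θ}φ|_β ≤ N N₁, where |f|_β := |f|₀ + [f]_β for β ∈ (0,1]. -/
open scoped ENNReal RealInnerProductSpace

noncomputable section

/-- `ℝ^d` with the Euclidean norm. -/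
abbrev Euc (d : ℕ) : Type := EuclideanSpace ℝ (Fin d)

/-- The weight `r₁(x) = (1 + |x|²)^{1/2}`. -/
def r1 {d : ℕ} (x : Euc d) : ℝ := Real.sqrt (1 + ‖x‖ ^ 2)

/-- Sup-norm `|f|₀ = sup_x ‖f x‖`, valued in `[0,∞]`. -/
def nrm0 {d : ℕ} {V : Type*} [NormedAddCommGroup V] (f : Euc d → V) : ℝ≥0∞ :=
  ⨆ x, (‖f x‖₊ : ℝ≥0∞)

/-- Hölder seminorm `[f]_β = sup_{x ≠ y} ‖f x - f y‖ / ‖x - y‖^β`, valued in `[0,∞]`. -/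
def hsemi {d : ℕ} {V : Type*} [NormedAddCommGroup V] (β : ℝ) (f : Euc d → V) : ℝ≥0∞ :=
  ⨆ (x : Euc d) (y : Euc d) (_ : x ≠ y),
    (‖f x - f y‖₊ : ℝ≥0∞) / ENNReal.ofReal (‖x - y‖ ^ β)

/-- Partial derivative in the `i`-th coordinate direction. -/
def pder {d : ℕ} {V : Type*} [NormedAddCommGroup V] [NormedSpace ℝ V]
    (i : Fin d) (f : Euc d → V) : Euc d → V :=
  fun x => fderiv ℝ f x (EuclideanSpace.single i 1)

/-- Iterated partial derivative in the `i`-th coordinate direction. -/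
def pderPow {d : ℕ} {V : Type*} [NormedAddCommGroup V] [NormedSpace ℝ V]
    (i : Fin d) : ℕ → (Euc d → V) → Euc d → V
  | 0, f => f
  | n + 1, f => pder i (pderPow i n f)

/-- Multi-index partial derivative `∂^γ f = ∂_1^{γ 1} ⋯ ∂_d^{γ d} f`. -/
def mder {d : ℕ} {V : Type*} [NormedAddCommGroup V] [NormedSpace ℝ V]
    (γ : Fin d → ℕ) (f : Euc d → V) : Euc d → V :=
  (List.finRange d).foldr (fun i g => pderPow i (γ i) g) f

/-- `[β]⁻`: for `β > 0`, the nonnegative integer with `β = [β]⁻ + {β}⁺`, `{β}⁺ ∈ (0,1]`. -/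
def ifl (β : ℝ) : ℕ := ⌈β⌉₊ - 1

/-- `{β}⁺`: the fractional part in `(0,1]` of `β > 0`. -/
def frc (β : ℝ) : ℝ := β - (ifl β : ℝ)

/-- Hölder norm `|f|_β = Σ_{|γ| ≤ [β]⁻} |∂^γ f|₀ + Σ_{|γ| = [β]⁻} [∂^γ f]_{{β}⁺}`,
valued in `[0,∞]`. -/
def holNorm {d : ℕ} {V : Type*} [NormedAddCommGroup V] [NormedSpace ℝ V]
    (β : ℝ) (f : Euc d → V) : ℝ≥0∞ :=
  (∑' γ : {γ : Fin d → ℕ // (∑ i, γ i) ≤ ifl β}, nrm0 (mder γ.1 f))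
    + ∑' γ : {γ : Fin d → ℕ // (∑ i, γ i) = ifl β}, hsemi (frc β) (mder γ.1 f)

/-- `H̃(x) = x + H(x)`. -/
def tilde {d : ℕ} (H : Euc d → Euc d) : Euc d → Euc d := fun x => x + H x

/-- `H̃⁻¹`, the inverse map of `H̃`. -/
def tildeInv {d : ℕ} (H : Euc d → Euc d) : Euc d → Euc d := Function.invFun (tilde H)

/-- `F(x) = H̃⁻¹(x) - x`, so that `H̃⁻¹(x) = x + F(x)`. -/
def Fof {d : ℕ} (H : Euc d → Euc d) : Euc d → Euc d := fun x => tildeInv H x - x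

lemma one_le_r1 {d : ℕ} (x : Euc d) : 1 ≤ r1 x := by
  rw [r1, Real.one_le_sqrt]
  nlinarith [sq_nonneg ‖x‖]

lemma r1_sub_le {d : ℕ} (x y : Euc d) : r1 x - r1 y ≤ ‖x - y‖ := by
  rw [sub_le_iff_le_add, r1, Real.sqrt_le_iff]
  have hy := one_le_r1 y
  have hsq : r1 y ^ 2 = 1 + ‖y‖ ^ 2 := Real.sq_sqrt (by positivity)
  have hle : ‖y‖ ≤ r1 y := Real.le_sqrt_of_sq_le (by linarith)
  have htri : ‖x‖ ≤ ‖x - y‖ + ‖y‖ := by simpa using norm_add_le (x - y) y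
  have hxy := norm_nonneg (x - y)
  refine ⟨by linarith, ?_⟩
  nlinarith [mul_le_mul_of_nonneg_left hle hxy, norm_nonneg x, norm_nonneg y,
    mul_self_le_mul_self (norm_nonneg x) htri]

lemma nrm0_le_ofReal_iff {d : ℕ} {V : Type*} [NormedAddCommGroup V] {f : Euc d → V} {a : ℝ}
    (ha : 0 ≤ a) : nrm0 f ≤ ENNReal.ofReal a ↔ ∀ x, ‖f x‖ ≤ a := by
  simp only [nrm0, iSup_le_iff, ← enorm_eq_nnnorm, ← ofReal_norm, ENNReal.ofReal_le_ofReal_iff ha]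

lemma hsemi_le_ofReal_iff {d : ℕ} {V : Type*} [NormedAddCommGroup V] {f : Euc d → V} {β b : ℝ}
    (hb : 0 ≤ b) :
    hsemi β f ≤ ENNReal.ofReal b ↔ ∀ x y, ‖f x - f y‖ ≤ b * ‖x - y‖ ^ β := by
  simp only [hsemi, iSup_le_iff]
  refine forall₂_congr fun x y => ?_
  rcases eq_or_ne x y with rfl | hxy
  · simpa using mul_nonneg hb (Real.rpow_nonneg le_rfl β)
  · have hpos : 0 < ‖x - y‖ ^ β := Real.rpow_pos_of_pos (norm_pos_iff.2 (sub_ne_zero.2 hxy)) β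
    rw [forall_prop_of_true hxy, ← enorm_eq_nnnorm, ← ofReal_norm, ← ENNReal.ofReal_div_of_pos hpos,
      ENNReal.ofReal_le_ofReal_iff hb, div_le_iff₀ hpos]

/-- Bernoulli's inequality, in a form valid for every exponent. -/
lemma one_sub_rpow_le {t : ℝ} (ht : 0 < t) (ht1 : t ≤ 1) (s : ℝ) :
    1 - t ^ s ≤ max s 1 * (1 - t) := by
  have hB := one_add_mul_self_le_rpow_one_add (s := t - 1) (by linarith) (le_max_right s 1)
  rw [add_sub_cancel] at hB
  have := Real.rpow_le_rpow_of_exponent_ge ht ht1 (le_max_left s 1)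
  linarith

lemma le_rpow_of_le_one_of_le {u v β : ℝ} (hu : u ≤ 1) (hv : 0 ≤ v) (huv : u ≤ v)
    (hβ : 0 ≤ β) (hβ1 : β ≤ 1) : u ≤ v ^ β := by
  rcases le_total v 1 with h | h
  · exact huv.trans (Real.self_le_rpow_of_le_one hv h hβ1)
  · exact hu.trans (Real.one_le_rpow h hβ)

lemma one_sub_r1_div_rpow_le {d : ℕ} {x y : Euc d} (hyx : r1 y ≤ r1 x) {β : ℝ} (hβ : 0 ≤ β)
    (hβ1 : β ≤ 1) (s : ℝ) : 1 - (r1 y / r1 x) ^ s ≤ max s 1 * ‖x - y‖ ^ β := by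
  have hx := one_le_r1 x
  have hx0 : 0 < r1 x := by linarith
  have hy0 : 0 < r1 y := by linarith [one_le_r1 y]
  have ht : 0 < r1 y / r1 x := by positivity
  refine (one_sub_rpow_le ht (div_le_one_of_le₀ hyx hx0.le) s).trans ?_
  refine mul_le_mul_of_nonneg_left ?_ (by positivity)
  refine le_rpow_of_le_one_of_le (by linarith) (norm_nonneg _) ?_ hβ hβ1
  rw [one_sub_div hx0.ne']
  exact (div_le_self (by linarith) hx).trans (r1_sub_le x y)

/-- Multiplication by a decaying weight preserves Hölder continuity of a function which is
dominated by the inverse weight. -/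
lemma norm_r1_rpow_mul_sub_le {d : ℕ} {g : Euc d → ℝ} {a b s β : ℝ} (hs : 0 ≤ s) (hβ : 0 ≤ β)
    (hβ1 : β ≤ 1) (ha : ∀ x, ‖r1 x ^ (-s) * g x‖ ≤ a)
    (hb : ∀ x y, ‖g x - g y‖ ≤ b * ‖x - y‖ ^ β) (x y : Euc d) :
    ‖r1 x ^ (-s) * g x - r1 y ^ (-s) * g y‖ ≤ (b + max s 1 * a) * ‖x - y‖ ^ β := by
  wlog hyx : r1 y ≤ r1 x generalizing x y
  · rw [norm_sub_rev, norm_sub_rev x]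
    exact this y x (le_of_not_ge hyx)
  have hx := one_le_r1 x
  have hx0 : 0 < r1 x := by linarith
  have hy0 : 0 < r1 y := by linarith [one_le_r1 y]
  have hdecomp : r1 x ^ (-s) * g x - r1 y ^ (-s) * g y
      = r1 x ^ (-s) * (g x - g y) - (1 - (r1 y / r1 x) ^ s) * (r1 y ^ (-s) * g y) := by
    rw [Real.div_rpow hy0.le hx0.le, Real.rpow_neg hx0.le, Real.rpow_neg hy0.le]
    have := (Real.rpow_pos_of_pos hx0 s).ne'
    have := (Real.rpow_pos_of_pos hy0 s).ne'
    field_simp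
    ring
  have hle : (r1 y / r1 x) ^ s ≤ 1 :=
    Real.rpow_le_one (by positivity) (div_le_one_of_le₀ hyx hx0.le) hs
  rw [hdecomp, add_mul, mul_right_comm]
  refine (norm_sub_le _ _).trans (add_le_add ?_ ?_)
  · rw [norm_mul, Real.norm_of_nonneg (by positivity)]
    exact (mul_le_of_le_one_left (norm_nonneg _)
      (Real.rpow_le_one_of_one_le_of_nonpos hx (by linarith))).trans (hb x y)
  · rw [norm_mul, Real.norm_of_nonneg (sub_nonneg.2 hle)]
    exact mul_le_mul (one_sub_r1_div_rpow_le hyx hβ hβ1 s) (ha y) (norm_nonneg _) (by positivity)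

/-- equivalence of weighted norms with the maximal weight. -/
theorem stmt_4 (β θ₁ θ₂ : ℝ) (hβ : β ∈ Set.Ioc (0 : ℝ) 1) :
    ∃ N : ℝ, 0 < N ∧
      ∀ (d : ℕ), 1 ≤ d →
        ∀ φ : Euc d → ℝ,
          nrm0 (fun x => r1 x ^ (-θ₁) * φ x) + hsemi β (fun x => r1 x ^ (-θ₂) * φ x) ≠ ⊤ →
          nrm0 (fun x => r1 x ^ (-(max θ₁ θ₂)) * φ x)
              + hsemi β (fun x => r1 x ^ (-(max θ₁ θ₂)) * φ x) ≤
            ENNReal.ofReal N *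
              (nrm0 (fun x => r1 x ^ (-θ₁) * φ x)
                + hsemi β (fun x => r1 x ^ (-θ₂) * φ x)) := by
  obtain ⟨hβ0, hβ1⟩ := hβ
  have hM : 1 ≤ max (θ₁ - θ₂) 1 := le_max_right _ _
  refine ⟨1 + max (θ₁ - θ₂) 1, by linarith, fun d _ φ hfin => ?_⟩
  obtain ⟨hA, hB⟩ := ENNReal.add_ne_top.1 hfin
  rcases le_total θ₁ θ₂ with h | h
  · rw [max_eq_right h]
    have hmono : nrm0 (fun x => r1 x ^ (-θ₂) * φ x) ≤ nrm0 (fun x => r1 x ^ (-θ₁) * φ x) := by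
      refine iSup_mono fun x => ENNReal.coe_le_coe.2 ?_
      have hx := one_le_r1 x
      have hx0 : 0 ≤ r1 x := by linarith
      rw [← NNReal.coe_le_coe, coe_nnnorm, coe_nnnorm, norm_mul, norm_mul,
        Real.norm_of_nonneg (Real.rpow_nonneg hx0 _), Real.norm_of_nonneg (Real.rpow_nonneg hx0 _)]
      exact mul_le_mul_of_nonneg_right
        (Real.rpow_le_rpow_of_exponent_le hx (neg_le_neg h)) (norm_nonneg _)
    refine (add_le_add_left hmono _).trans (le_mul_of_one_le_left zero_le ?_)
    exact ENNReal.one_le_ofReal.2 (by linarith)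
  · rw [max_eq_left h]
    have hfac (x : Euc d) : r1 x ^ (-θ₁) * φ x
        = r1 x ^ (-(θ₁ - θ₂)) * (r1 x ^ (-θ₂) * φ x) := by
      rw [← mul_assoc, ← Real.rpow_add (by linarith [one_le_r1 x])]
      ring_nf
    generalize hAa : nrm0 (fun x => r1 x ^ (-θ₁) * φ x) = A at hA ⊢
    generalize hBb : hsemi β (fun x => r1 x ^ (-θ₂) * φ x) = B at hB ⊢
    lift A to NNReal using hA
    lift B to NNReal using hB
    rw [← ENNReal.ofReal_coe_nnreal] at hAa hBb
    have hsup := (nrm0_le_ofReal_iff A.coe_nonneg).1 hAa.le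
    have hhol := (hsemi_le_ofReal_iff B.coe_nonneg).1 hBb.le
    simp only [hfac] at hsup ⊢
    have hkey := (hsemi_le_ofReal_iff (by positivity)).2
      (norm_r1_rpow_mul_sub_le (sub_nonneg.2 h) hβ0.le hβ1 hsup hhol)
    refine (add_le_add_right hkey _).trans ?_
    rw [← ENNReal.ofReal_coe_nnreal, ← ENNReal.ofReal_coe_nnreal,
      ← ENNReal.ofReal_add A.coe_nonneg (by positivity), ← ENNReal.ofReal_add A.coe_nonneg B.coe_nonneg,
      ← ENNReal.ofReal_mul (by positivity)]
    refine ENNReal.ofReal_le_ofReal ?_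
    have := mul_nonneg (zero_le_one.trans hM) B.coe_nonneg
    linarith
end
end

section
/- Let d ≥ 1 and θ₁, θ₂ ∈ ℝ with θ₁ − θ₂ ≤ 1. Then there is a constant N = N(θ₂) such that for every continuously differentiable function φ: ℝ^d → ℝ with |r₁^{−θ₁}φ|₀ + |r₁^{−θ₂}∇φ|₀ < ∞ one has [r₁^{−θ₂}φ]₁ ≤ N (|r₁^{−θ₁}φ|₀ + |r₁^{−θ₂}∇φ|₀), where ∇φ denotes the gradient of φ. -/
open scoped ENNReal RealInnerProductSpace

noncomputable section

lemma norm_le_r1 {d : ℕ} (x : Euc d) : ‖x‖ ≤ r1 x :=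
  Real.le_sqrt_of_sq_le (by linarith)

lemma hasFDerivAt_r1 {d : ℕ} (x : Euc d) :
    HasFDerivAt (r1 (d := d)) ((r1 x)⁻¹ • innerSL ℝ x) x := by
  have hsq : HasFDerivAt (fun y : Euc d => 1 + ‖y‖ ^ 2) (2 • innerSL ℝ x) x :=
    (hasStrictFDerivAt_norm_sq x).hasFDerivAt.const_add 1
  refine (hsq.sqrt (by positivity)).congr_fderiv ?_
  rw [← Nat.cast_smul_eq_nsmul ℝ, smul_smul, r1]
  congr 1
  field_simp
  norm_num

lemma norm_inv_r1_smul_innerSL_le {d : ℕ} (x : Euc d) :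
    ‖(r1 x)⁻¹ • innerSL ℝ x‖ ≤ 1 := by
  have hr : 0 < r1 x := zero_lt_one.trans_le (one_le_r1 x)
  rw [norm_smul, innerSL_apply_norm, norm_inv, Real.norm_of_nonneg hr.le,
    inv_mul_le_one₀ hr]
  exact norm_le_r1 x

lemma norm_le_toReal_nrm0 {d : ℕ} {V : Type*} [NormedAddCommGroup V] {f : Euc d → V}
    (hf : nrm0 f ≠ ⊤) (x : Euc d) : ‖f x‖ ≤ (nrm0 f).toReal := by
  have h : (‖f x‖₊ : ℝ≥0∞) ≤ nrm0 f := le_iSup (fun y => (‖f y‖₊ : ℝ≥0∞)) x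
  simpa using ENNReal.toReal_mono hf h

/-- A global Lipschitz bound controls the seminorm `[f]₁`. -/
lemma hsemi_one_le_of_norm_sub_le {d : ℕ} {V : Type*} [NormedAddCommGroup V] {f : Euc d → V}
    {C : ℝ} (hf : ∀ x y, ‖f x - f y‖ ≤ C * ‖x - y‖) : hsemi 1 f ≤ ENNReal.ofReal C := by
  refine iSup_le fun x => iSup_le fun y => iSup_le fun hxy => ?_
  have hpos : 0 < ‖x - y‖ := norm_pos_iff.2 (sub_ne_zero.2 hxy)
  rw [Real.rpow_one, ← enorm_eq_nnnorm, ← ofReal_norm, ← ENNReal.ofReal_div_of_pos hpos]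
  exact ENNReal.ofReal_le_ofReal ((div_le_iff₀ hpos).2 (hf x y))

lemma hasFDerivAt_r1_rpow_mul {d : ℕ} {φ : Euc d → ℝ} {x : Euc d}
    (hφ : DifferentiableAt ℝ φ x) (p : ℝ) :
    HasFDerivAt (fun y => r1 y ^ p * φ y)
      (r1 x ^ p • fderiv ℝ φ x +
        φ x • ((p * r1 x ^ (p - 1)) • ((r1 x)⁻¹ • innerSL ℝ x))) x :=
  ((hasFDerivAt_r1 x).rpow_const
    (Or.inl (zero_lt_one.trans_le (one_le_r1 x)).ne')).mul hφ.hasFDerivAt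

/-- Lipschitz seminorm bound via the gradient. -/
theorem stmt_7 (θ₂ : ℝ) :
    ∃ N : ℝ, 0 < N ∧
      ∀ (d : ℕ), 1 ≤ d → ∀ θ₁ : ℝ, θ₁ - θ₂ ≤ 1 →
        ∀ φ : Euc d → ℝ, ContDiff ℝ 1 φ →
          nrm0 (fun x => r1 x ^ (-θ₁) * φ x)
            + nrm0 (fun x => r1 x ^ (-θ₂) • fderiv ℝ φ x) ≠ ⊤ →
          hsemi 1 (fun x => r1 x ^ (-θ₂) * φ x) ≤
            ENNReal.ofReal N *
              (nrm0 (fun x => r1 x ^ (-θ₁) * φ x)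
                + nrm0 (fun x => r1 x ^ (-θ₂) • fderiv ℝ φ x)) := by
  refine ⟨1 + |θ₂|, by positivity, fun d _ θ₁ hθ φ hφ hfin => ?_⟩
  obtain ⟨hA, hB⟩ := ENNReal.add_ne_top.1 hfin
  set A := nrm0 (fun x => r1 x ^ (-θ₁) * φ x)
  set B := nrm0 (fun x => r1 x ^ (-θ₂) • fderiv ℝ φ x)
  have hdiff := hφ.differentiable one_ne_zero
  have bound : ∀ x : Euc d, ‖r1 x ^ (-θ₂) • fderiv ℝ φ x +
      φ x • ((-θ₂ * r1 x ^ (-θ₂ - 1)) • ((r1 x)⁻¹ • innerSL ℝ x))‖ ≤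
      (1 + |θ₂|) * (A + B).toReal := by
    intro x
    have hr := one_le_r1 x
    have hr0 : 0 ≤ r1 x := zero_le_one.trans hr
    have hgrad : ‖r1 x ^ (-θ₂) • fderiv ℝ φ x‖ ≤ B.toReal := norm_le_toReal_nrm0 hB x
    have hval : r1 x ^ (-θ₁) * |φ x| ≤ A.toReal := by
      have h : ‖r1 x ^ (-θ₁) * φ x‖ ≤ A.toReal := norm_le_toReal_nrm0 hA x
      rwa [norm_mul, Real.norm_of_nonneg (Real.rpow_nonneg hr0 _), Real.norm_eq_abs] at h
    have hpow : r1 x ^ (-θ₂ - 1) ≤ r1 x ^ (-θ₁) :=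
      Real.rpow_le_rpow_of_exponent_le hr (by linarith)
    have hweight : ‖φ x • ((-θ₂ * r1 x ^ (-θ₂ - 1)) • ((r1 x)⁻¹ • innerSL ℝ x))‖ ≤
        |θ₂| * A.toReal := by
      rw [norm_smul, norm_smul, norm_mul, norm_neg,
        Real.norm_of_nonneg (Real.rpow_nonneg hr0 (-θ₂ - 1)), Real.norm_eq_abs, Real.norm_eq_abs]
      calc |φ x| * (|θ₂| * r1 x ^ (-θ₂ - 1) * ‖(r1 x)⁻¹ • innerSL ℝ x‖)
          ≤ |φ x| * (|θ₂| * r1 x ^ (-θ₁) * 1) := by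
            gcongr
            exact norm_inv_r1_smul_innerSL_le x
        _ = |θ₂| * (r1 x ^ (-θ₁) * |φ x|) := by ring
        _ ≤ |θ₂| * A.toReal := by gcongr
    rw [ENNReal.toReal_add hA hB]
    have hA0 : 0 ≤ A.toReal := ENNReal.toReal_nonneg
    have hB0 : 0 ≤ |θ₂| * B.toReal := by positivity
    linarith [norm_add_le_of_le hgrad hweight]
  have hlip := hsemi_one_le_of_norm_sub_le fun x y =>
    convex_univ.norm_image_sub_le_of_norm_hasFDerivWithin_le
      (fun z _ => (hasFDerivAt_r1_rpow_mul (hdiff z) (-θ₂)).hasFDerivWithinAt)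
      (fun z _ => bound z) (Set.mem_univ y) (Set.mem_univ x)
  rwa [ENNReal.ofReal_mul (by positivity), ENNReal.ofReal_toReal hfin] at hlip
end
end
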